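/- arXiv:1507.01301 — 2 statements merged into one kernel-verified Lean document; each statement's English description precedes it below -/
import Mathlib

section
/- Let 𝒜 be a complex Banach algebra with identity which has property (𝔹), let ℳ be a Banach left 𝒜-module, and let δ : 𝒜 → ℳ be a continuous linear map. Then δ satisfies condition (D4) if and only if there exists ξ ∈ ℳ such that δ(AB + BA) = 2Aδ(B) + 2Bδ(A) − (AB + BA)ξ for all A, B ∈ 𝒜. -/
/-- A jointly continuous bilinear map between complex normed spaces can be curried to a
continuous linear map into a space of continuous linear maps. -/
theorem LinearMap.exists_continuous_curry_of_continuous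
    {E F G : Type*} [NormedAddCommGroup E] [NormedSpace ℂ E] [NormedAddCommGroup F]
    [NormedSpace ℂ F] [NormedAddCommGroup G] [NormedSpace ℂ G]
    (f : E →ₗ[ℂ] F →ₗ[ℂ] G) (hf : Continuous fun p : E × F => f p.1 p.2) :
    ∃ g : E →L[ℂ] F →L[ℂ] G, ∀ x y, g x y = f x y := by
  obtain ⟨ε, hε, H⟩ := Metric.continuousAt_iff.1 (hf.continuousAt (x := (0, 0))) 1 one_pos
  have hnorm : ∀ x : E, ∀ y : F, ‖x‖ < ε → ‖y‖ < ε → ‖f x y‖ < 1 := fun x y hx hy => by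
    simpa using @H (x, y) (by simpa [dist_eq_norm, Prod.norm_def] using ⟨hx, hy⟩)
  refine ⟨f.mkContinuous₂ ((2 / ε) ^ 2) fun x y => ?_, fun x y => rfl⟩
  rcases eq_or_ne x 0 with rfl | hx
  · simp
  rcases eq_or_ne y 0 with rfl | hy
  · simp
  have hx' := norm_pos_iff.2 hx
  have hy' := norm_pos_iff.2 hy
  have key := hnorm (((ε / 2 / ‖x‖ : ℝ) : ℂ) • x) (((ε / 2 / ‖y‖ : ℝ) : ℂ) • y)
    (by rw [norm_smul, Complex.norm_real, Real.norm_of_nonneg (by positivity),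
          div_mul_cancel₀ _ hx'.ne']; linarith)
    (by rw [norm_smul, Complex.norm_real, Real.norm_of_nonneg (by positivity),
          div_mul_cancel₀ _ hy'.ne']; linarith)
  rw [map_smul, map_smul, LinearMap.smul_apply, norm_smul, norm_smul, Complex.norm_real,
    Complex.norm_real, Real.norm_of_nonneg (by positivity),
    Real.norm_of_nonneg (by positivity)] at key
  calc ‖f x y‖ = (2 / ε) ^ 2 * ‖x‖ * ‖y‖ *
        (ε / 2 / ‖y‖ * (ε / 2 / ‖x‖ * ‖f x y‖)) := by field_simp
    _ ≤ (2 / ε) ^ 2 * ‖x‖ * ‖y‖ * 1 := by gcongr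
    _ = (2 / ε) ^ 2 * ‖x‖ * ‖y‖ := mul_one _

/-- Over a unital Banach algebra with property (𝔹) (tested on scalar-valued maps), a continuous
bilinear form vanishing on two-sided zero products is determined by its values at `1`. -/
theorem ContinuousLinearMap.apply_add_apply_swap_of_zero_product
    {A : Type*} [NormedRing A] [NormedAlgebra ℂ A]
    (hB : ∀ φ : A →L[ℂ] A →L[ℂ] ℂ, (∀ a b : A, a * b = 0 → φ a b = 0) →
      ∀ a b c : A, φ (a * b) c = φ a (b * c))
    (φ : A →L[ℂ] A →L[ℂ] ℂ) (hφ : ∀ a b : A, a * b = 0 → b * a = 0 → φ a b = 0) (a b : A) :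
    φ a b + φ b a = φ (b * a) 1 + φ 1 (a * b) := by
  have shift : ∀ a b y : A, a * b = 0 → φ (b * y) a = φ b (y * a) := by
    intro a b y hab
    have h := hB (φ.bilinearComp (ContinuousLinearMap.mul ℂ A b)
      ((ContinuousLinearMap.mul ℂ A).flip a)) (fun x z hxz => by
        refine hφ _ _ ?_ ?_
        · change b * x * (z * a) = 0
          rw [mul_assoc, ← mul_assoc x, hxz, zero_mul, mul_zero]
        · change z * a * (b * x) = 0
          rw [mul_assoc, ← mul_assoc a, hab, zero_mul, mul_zero]) 1 y 1
    simpa using h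
  have h := hB
    ((φ.bilinearComp ((ContinuousLinearMap.mul ℂ A).flip a) (ContinuousLinearMap.id ℂ A)
      - φ.bilinearComp (ContinuousLinearMap.id ℂ A) (ContinuousLinearMap.mul ℂ A a)).flip)
    (fun x z hxz => by simpa [sub_eq_zero] using shift x z a hxz) 1 b 1
  simp only [ContinuousLinearMap.flip_apply, sub_apply,
    ContinuousLinearMap.bilinearComp_apply, ContinuousLinearMap.mul_apply',
    ContinuousLinearMap.id_apply, one_mul, mul_one] at h
  linear_combination h


/-- Over a unital Banach algebra with property (𝔹), a continuous linear map `δ`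
into a Banach left module satisfies (D4) iff `δ` is a generalized Jordan left
derivation with some `ξ ∈ ℳ`. -/
theorem stmt_18
    {A : Type*} [NormedRing A] [NormedAlgebra ℂ A] [CompleteSpace A]
    {M : Type*} [NormedAddCommGroup M] [NormedSpace ℂ M] [CompleteSpace M]
    [Module A M] [IsScalarTower ℂ A M]
    (hact : Continuous fun p : A × M => p.1 • p.2)
    (hB : ∀ (X : Type) [NormedAddCommGroup X] [NormedSpace ℂ X] [CompleteSpace X]
      (φ : A →L[ℂ] A →L[ℂ] X), (∀ a b : A, a * b = 0 → φ a b = 0) →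
      ∀ a b c : A, φ (a * b) c = φ a (b * c))
    (δ : A →L[ℂ] M) :
    (∀ a b : A, a * b + b * a = 0 → a • δ b + b • δ a = 0) ↔
      ∃ ξ : M, ∀ a b : A, δ (a * b + b * a) =
        (2 : ℂ) • (a • δ b) + (2 : ℂ) • (b • δ a) - (a * b + b * a) • ξ := by
  constructor
  · intro h
    obtain ⟨T, hT⟩ := LinearMap.exists_continuous_curry_of_continuous
      (LinearMap.mk₂ ℂ (fun (a : A) (m : M) => a • m) add_smul smul_assoc smul_add
        (fun c a m => smul_comm a c m)) hact
    simp only [LinearMap.mk₂_apply] at hT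
    refine ⟨δ 1, fun a b => ?_⟩
    refine (SeparatingDual.eq_iff_forall_dual_eq (R := ℂ)).2 fun f => ?_
    let S : A →L[ℂ] A →L[ℂ] M := T.bilinearComp (ContinuousLinearMap.id ℂ A) δ
    have hS : ∀ x y, (S + S.flip) x y = x • δ y + y • δ x := fun x y => by simp [S, hT]
    let φ : A →L[ℂ] A →L[ℂ] ℂ := (ContinuousLinearMap.compL ℂ A M ℂ f).comp (S + S.flip)
    have hφ : ∀ x y, φ x y = f (x • δ y + y • δ x) := fun x y => congrArg f (hS x y)
    have key := φ.apply_add_apply_swap_of_zero_product (hB ℂ) (fun x y hxy hyx => by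
      rw [hφ, h x y (by rw [hxy, hyx, add_zero]), map_zero]) a b
    simp only [hφ, one_smul, map_add] at key
    simp only [map_sub, map_add, map_smul, add_smul, smul_eq_mul]
    linear_combination -key
  · rintro ⟨ξ, h⟩ a b hab
    have h2 := h a b
    rw [hab, map_zero, zero_smul, sub_zero, ← smul_add] at h2
    exact (smul_eq_zero.1 h2.symm).resolve_left two_ne_zero
end

section
/- Let 𝒜 be a complex Banach algebra with identity which has property (𝔹), let ℳ be a Banach left 𝒜-module, let C be an element of the centre Z(𝒜) of 𝒜 which is a left separating point of ℳ, and let δ : 𝒜 → ℳ be a continuous linear map. Then δ satisfies condition (D2) if and only if there exists ξ ∈ ℳ such that δ(AB) = Aδ(B) + Bδ(A) − (AB)ξ for all A, B ∈ 𝒜. -/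
/-- A jointly continuous bilinear map, as a continuous linear map into continuous linear maps. -/
theorem LinearMap.exists_continuousLinearMap_of_continuous_uncurry
    {𝕜 E F G : Type*} [NontriviallyNormedField 𝕜]
    [NormedAddCommGroup E] [NormedSpace 𝕜 E] [NormedAddCommGroup F] [NormedSpace 𝕜 F]
    [NormedAddCommGroup G] [NormedSpace 𝕜 G] (f : E →ₗ[𝕜] F →ₗ[𝕜] G)
    (hf : Continuous fun p : E × F => f p.1 p.2) :
    ∃ φ : E →L[𝕜] F →L[𝕜] G, ∀ x y, φ x y = f x y := by
  let B : E →ₗ[𝕜] F →L[𝕜] G :=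
    { toFun := fun x => ⟨f x, hf.comp (Continuous.prodMk_right x)⟩
      map_add' := fun x y => by ext; simp
      map_smul' := fun c x => by ext; simp }
  exact ⟨⟨B, ContinuousLinearMap.continuous_of_continuous_uncurry B hf⟩, fun _ _ => rfl⟩

/-- Property (𝔹), tested on scalar-valued bilinear maps, passes to jointly continuous bilinear
maps with values in any normed space. -/
theorem map_mul_eq_map_mul_of_forall_scalar
    {A : Type*} [NormedRing A] [NormedAlgebra ℂ A]
    {M : Type*} [NormedAddCommGroup M] [NormedSpace ℂ M]
    (hB : ∀ φ : A →L[ℂ] A →L[ℂ] ℂ, (∀ a b : A, a * b = 0 → φ a b = 0) →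
      ∀ a b c : A, φ (a * b) c = φ a (b * c))
    (ψ : A →ₗ[ℂ] A →ₗ[ℂ] M) (hψ : Continuous fun p : A × A => ψ p.1 p.2)
    (h0 : ∀ a b : A, a * b = 0 → ψ a b = 0) (a b c : A) :
    ψ (a * b) c = ψ a (b * c) := by
  refine (SeparatingDual.eq_iff_forall_dual_eq (R := ℂ)).2 fun g => ?_
  obtain ⟨φ, hφ⟩ := LinearMap.exists_continuousLinearMap_of_continuous_uncurry
    (ψ.compr₂ g.toLinearMap) (g.continuous.comp hψ)
  have h := hB φ (fun x y hxy => by simp [hφ, h0 x y hxy]) a b c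
  simpa [hφ] using h

/-- Over a unital Banach algebra with property (𝔹), with a central left separating
point `C` of the Banach left module `ℳ`, a continuous linear map `δ` satisfies (D2)
iff `δ` is a generalized left derivation with some `ξ ∈ ℳ`. -/
theorem stmt_19
    {A : Type*} [NormedRing A] [NormedAlgebra ℂ A] [CompleteSpace A]
    {M : Type*} [NormedAddCommGroup M] [NormedSpace ℂ M] [CompleteSpace M]
    [Module A M] [IsScalarTower ℂ A M]
    (hact : Continuous fun p : A × M => p.1 • p.2)
    (hB : ∀ (X : Type) [NormedAddCommGroup X] [NormedSpace ℂ X] [CompleteSpace X]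
      (φ : A →L[ℂ] A →L[ℂ] X), (∀ a b : A, a * b = 0 → φ a b = 0) →
      ∀ a b c : A, φ (a * b) c = φ a (b * c))
    (C : A) (hCc : ∀ b : A, C * b = b * C) (hsep : ∀ m : M, C • m = 0 → m = 0)
    (δ : A →L[ℂ] M) :
    (∀ a b : A, a * b = 0 → a • δ b + b • δ a = 0) ↔
      ∃ ξ : M, ∀ a b : A, δ (a * b) = a • δ b + b • δ a - (a * b) • ξ := by
  constructor
  · intro h
    have hcomm : ∀ (a : A) (z : ℂ) (m : M), a • z • m = z • a • m := fun a z m => by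
      rw [← one_smul A m, ← smul_assoc z (1 : A) m, smul_smul, smul_smul, ← smul_assoc]
      simp
    let ψ : A →ₗ[ℂ] A →ₗ[ℂ] M := LinearMap.mk₂ ℂ (fun a b => a • δ b + b • δ a)
      (fun a₁ a₂ b => by simp only [add_smul, map_add, smul_add]; abel)
      (fun z a b => by simp only [map_smul, smul_add, smul_assoc, hcomm])
      (fun a b₁ b₂ => by simp only [add_smul, map_add, smul_add]; abel)
      (fun z a b => by simp only [map_smul, smul_add, smul_assoc, hcomm])
    have hψ : Continuous fun p : A × A => ψ p.1 p.2 :=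
      (hact.comp (continuous_fst.prodMk (δ.continuous.comp continuous_snd))).add
        (hact.comp (continuous_snd.prodMk (δ.continuous.comp continuous_fst)))
    refine ⟨δ 1, fun a b => eq_sub_of_add_eq ?_⟩
    have key := map_mul_eq_map_mul_of_forall_scalar (hB ℂ) ψ hψ h 1 a b
    simpa [ψ] using key.symm
  · rintro ⟨ξ, hξ⟩ a b hab
    simpa [hab] using (hξ a b).symm
end
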